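/- Let R := MvPolynomial (Fin 3) ℂ with creation operators a†_j (multiplication by X_j) and annihilation operators a_j (pderiv j) for j ∈ {1,2,3}. Set h₁₂ := a†₁∘a₂ + a†₂∘a₁, h₂₃ := a†₂∘a₃ + a†₃∘a₂, and h₁₃ := ⁅h₁₂, h₂₃⁆. Then for every g ∈ Module.End ℂ R with ⁅g, h₂₃⁆ = 0 one has 2•⁅⁅g, h₁₃⁆, h₁₂⁆ = ⁅⁅⁅g, h₁₂⁆, h₁₂⁆, h₂₃⁆. -/

import Mathlib

open MvPolynomial

noncomputable section

/-- Creation operator at site `j` of the three-site bosonic chain: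
multiplication by the variable `X j` on `MvPolynomial (Fin 3) ℂ`. -/
def ad (j : Fin 3) : Module.End ℂ (MvPolynomial (Fin 3) ℂ) := LinearMap.mulLeft ℂ (X j)

/-- Annihilation operator at site `j`: the partial derivative `pderiv j`. -/
def an (j : Fin 3) : Module.End ℂ (MvPolynomial (Fin 3) ℂ) := (pderiv j).toLinearMap

/-- Symmetric nearest-neighbor hopping between sites 1 and 2. -/
def h12 : Module.End ℂ (MvPolynomial (Fin 3) ℂ) := ad 0 * an 1 + ad 1 * an 0

/-- Symmetric nearest-neighbor hopping between sites 2 and 3. -/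
def h23 : Module.End ℂ (MvPolynomial (Fin 3) ℂ) := ad 1 * an 2 + ad 2 * an 1

/-- The next-nearest hopping operator `h₁₃ = ⁅h₁₂, h₂₃⁆`. -/
def h13 : Module.End ℂ (MvPolynomial (Fin 3) ℂ) := ⁅h12, h23⁆

/-- The symmetric hopping operator between two sites, as a derivation. -/
def hopDerivation (j l : Fin 3) :
    Derivation ℂ (MvPolynomial (Fin 3) ℂ) (MvPolynomial (Fin 3) ℂ) :=
  (X j : MvPolynomial (Fin 3) ℂ) • pderiv l + (X l : MvPolynomial (Fin 3) ℂ) • pderiv j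

theorem coe_hopDerivation (j l : Fin 3) :
    (hopDerivation j l : Module.End ℂ (MvPolynomial (Fin 3) ℂ)) =
      ad j * an l + ad l * an j := by
  ext1 p
  rfl

theorem lie_h12_h13 : ⁅h12, h13⁆ = h23 := by
  have key : ⁅hopDerivation 0 1, ⁅hopDerivation 0 1, hopDerivation 1 2⁆⁆ =
      hopDerivation 1 2 := by
    refine MvPolynomial.derivation_ext fun i => ?_
    fin_cases i <;>
      simp [hopDerivation, Derivation.commutator_apply, pderiv_X]
  rw [h13, h12, h23, ← coe_hopDerivation, ← coe_hopDerivation,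
    ← Derivation.commutator_coe_linear_map, ← Derivation.commutator_coe_linear_map, key]

/-- For every operator `g` commuting with `h₂₃` (in particular any operator supported
on site 1), `2•⁅⁅g,h₁₃⁆,h₁₂⁆ = ⁅⁅⁅g,h₁₂⁆,h₁₂⁆,h₂₃⁆`. -/
theorem splitting_identity (g : Module.End ℂ (MvPolynomial (Fin 3) ℂ))
    (hg : ⁅g, h23⁆ = 0) :
    2 • ⁅⁅g, h13⁆, h12⁆ = ⁅⁅⁅g, h12⁆, h12⁆, h23⁆ := by
  let _ : LieRing (Module.End ℂ (MvPolynomial (Fin 3) ℂ)) := LieRing.ofAssociativeRing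
  have h_jacobi : ⁅g, h13⁆ = ⁅⁅g, h12⁆, h23⁆ := by
    rw [h13, leibniz_lie, hg, lie_zero, add_zero]
  have h_symm : ⁅⁅g, h12⁆, h13⁆ = ⁅⁅g, h13⁆, h12⁆ := by
    have h := leibniz_lie g h12 h13
    rw [lie_h12_h13, hg, ← lie_skew h12 ⁅g, h13⁆] at h
    exact (add_neg_eq_zero.mp h.symm)
  have h_expand : ⁅⁅⁅g, h12⁆, h12⁆, h23⁆ = ⁅⁅⁅g, h12⁆, h23⁆, h12⁆ + ⁅⁅g, h12⁆, h13⁆ := by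
    rw [h13, leibniz_lie ⁅g, h12⁆ h12 h23, ← lie_skew h12 ⁅⁅g, h12⁆, h23⁆]
    abel
  rw [h_expand, h_symm, ← h_jacobi, two_nsmul]

end
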